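/- Let p, q be positive integers, n ≥ 2, and let (u, v₁, v₂) ∈ ℂ^{n−1}×ℂ×ℂ with ‖u‖² + |v₁|² + |v₂|² = 1, u ≠ 0, v₁ ≠ 0, v₂ ≠ 0. Set a := |v₁|, b := |v₂|, c := ‖u‖, X₁ := (0, i·v₁, 0), X₂ := (0, 0, i·v₂), w := (i·p·u, i·q·v₁, i·q·v₂), and let G be the 2×2 real Gram matrix G_{jk} := ⟨X_jʰ, X_kʰ⟩ of the horizontal parts with respect to w. Then det G = a²·b²·(1 − q²(1−c²)/(p²c² + q²(1−c²))). -/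

import Mathlib

open Matrix

/-- The Hermitian inner product `⟪z,w⟫ = ∑ k, z k * conj (w k)` on `ℂᵐ`. -/
noncomputable def hinner {m : ℕ} (z w : Fin m → ℂ) : ℂ :=
  ∑ k, z k * (starRingEnd ℂ) (w k)

/-- The real inner product `⟨z,w⟩ = Re ⟪z,w⟫` on `ℂᵐ`. -/
noncomputable def rinner {m : ℕ} (z w : Fin m → ℂ) : ℝ := (hinner z w).re

/-- The squared norm `‖z‖² = ⟨z,z⟩` on `ℂᵐ`. -/
noncomputable def nsq {m : ℕ} (z : Fin m → ℂ) : ℝ := rinner z z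

/-- The 1-form `κ^j_u(U) = ‖u‖²⟨ju,U⟩ − ⟨U,iu⟩⟨ju,iu⟩` associated with a matrix `j`. -/
noncomputable def kappa {m : ℕ} (j : Matrix (Fin m) (Fin m) ℂ) (u U : Fin m → ℂ) : ℝ :=
  nsq u * rinner (j.mulVec u) U -
    rinner U (Complex.I • u) * rinner (j.mulVec u) (Complex.I • u)

/-- The space `ℂᵐ × ℂ × ℂ`. -/
abbrev E (m : ℕ) := (Fin m → ℂ) × ℂ × ℂ

/-- The real inner product `⟨z,w⟩ = Re(z·conj w)` on `ℂ`. -/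
noncomputable def rc (z w : ℂ) : ℝ := (z * (starRingEnd ℂ) w).re

/-- The real inner product on `ℂᵐ × ℂ × ℂ`. -/
noncomputable def ripE {m : ℕ} (x y : E m) : ℝ :=
  rinner x.1 y.1 + rc x.2.1 y.2.1 + rc x.2.2 y.2.2

/-- The horizontal part `Xʰ = X − (⟨X,w⟩/‖w‖²)·w` of `X` with respect to `w`. -/
noncomputable def hor {m : ℕ} (w X : E m) : E m :=
  X - (ripE X w / ripE w w) • w

theorem rinner_comm {m : ℕ} (z w : Fin m → ℂ) : rinner z w = rinner w z := by
  simp only [rinner, hinner, Complex.re_sum, Complex.mul_re, Complex.conj_re, Complex.conj_im]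
  exact Finset.sum_congr rfl fun _ _ => by ring

theorem rinner_sub_left {m : ℕ} (x y z : Fin m → ℂ) :
    rinner (x - y) z = rinner x z - rinner y z := by
  simp [rinner, hinner, sub_mul, Finset.sum_sub_distrib]

theorem rinner_smul_left {m : ℕ} (t : ℝ) (x z : Fin m → ℂ) :
    rinner (t • x) z = t * rinner x z := by
  simp only [rinner, hinner, Complex.re_sum, Finset.mul_sum, Pi.smul_apply, smul_mul_assoc,
    Complex.smul_re, smul_eq_mul]

theorem rinner_zero_left {m : ℕ} (z : Fin m → ℂ) : rinner 0 z = 0 := by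
  simp [rinner, hinner]

theorem rinner_complex_smul_self {m : ℕ} (t : ℂ) (x : Fin m → ℂ) :
    rinner (t • x) (t • x) = ‖t‖ ^ 2 * nsq x := by
  simp only [nsq, rinner, hinner, Complex.re_sum, Finset.mul_sum, Pi.smul_apply, smul_eq_mul,
    map_mul, Complex.mul_re, Complex.mul_im, Complex.conj_re, Complex.conj_im, Complex.sq_norm,
    Complex.normSq_apply]
  exact Finset.sum_congr rfl fun _ _ => by ring

theorem ripE_comm {m : ℕ} (x y : E m) : ripE x y = ripE y x := by
  simp only [ripE, rinner_comm x.1 y.1, rc, Complex.mul_re, Complex.conj_re, Complex.conj_im]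
  ring

theorem ripE_sub_left {m : ℕ} (x y z : E m) : ripE (x - y) z = ripE x z - ripE y z := by
  simp only [ripE, Prod.fst_sub, Prod.snd_sub, rinner_sub_left, rc, sub_mul, Complex.sub_re]
  ring

theorem ripE_smul_left {m : ℕ} (t : ℝ) (x z : E m) : ripE (t • x) z = t * ripE x z := by
  simp only [ripE, Prod.smul_fst, Prod.smul_snd, rinner_smul_left, rc, smul_mul_assoc,
    Complex.smul_re, smul_eq_mul]
  ring

theorem ripE_hor_hor {m : ℕ} {w : E m} (hw : ripE w w ≠ 0) (X Y : E m) :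
    ripE (hor w X) (hor w Y) = ripE X Y - ripE X w * ripE Y w / ripE w w := by
  have horizontal : ripE (hor w X) w = 0 := by
    rw [hor, ripE_sub_left, ripE_smul_left, div_mul_cancel₀ _ hw, sub_self]
  rw [ripE_comm, hor, ripE_sub_left, ripE_smul_left, ripE_comm w (hor w X), horizontal,
    ripE_comm Y, hor, ripE_sub_left, ripE_smul_left, ripE_comm w Y]
  ring

/-- equation (4.3) of the paper: the determinant of the Gram matrix of the
horizontal parts of the fundamental vectors of the torus action equals
`a²b²(1 − q²(1−c²)/(p²c² + q²(1−c²)))`. -/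
theorem horizontal_gram_det (p q n : ℕ) (hp : 0 < p) (hq : 0 < q) (hn : 2 ≤ n)
    (u : Fin (n - 1) → ℂ) (v₁ v₂ : ℂ)
    (hsphere : nsq u + ‖v₁‖ ^ 2 + ‖v₂‖ ^ 2 = 1)
    (hu : u ≠ 0) (hv₁ : v₁ ≠ 0) (hv₂ : v₂ ≠ 0)
    (a b c : ℝ) (hab : a = ‖v₁‖) (hb : b = ‖v₂‖) (hc : 0 ≤ c) (hc2 : c ^ 2 = nsq u)
    (X : Fin 2 → E (n - 1)) (w : E (n - 1))
    (hX0 : X 0 = (0, Complex.I * v₁, 0)) (hX1 : X 1 = (0, 0, Complex.I * v₂))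
    (hw : w = (((p : ℂ) * Complex.I) • u, (q : ℂ) * Complex.I * v₁, (q : ℂ) * Complex.I * v₂))
    (G : Matrix (Fin 2) (Fin 2) ℝ)
    (hG : G = Matrix.of fun j k => ripE (hor w (X j)) (hor w (X k))) :
    G.det = a ^ 2 * b ^ 2 *
      (1 - (q : ℝ) ^ 2 * (1 - c ^ 2) / ((p : ℝ) ^ 2 * c ^ 2 + (q : ℝ) ^ 2 * (1 - c ^ 2))) := by
  have sphere : 1 - c ^ 2 = a ^ 2 + b ^ 2 := by rw [hc2, hab, hb]; linarith
  have a_sq : a ^ 2 = v₁.re * v₁.re + v₁.im * v₁.im := by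
    rw [hab, Complex.sq_norm, Complex.normSq_apply]
  have b_sq : b ^ 2 = v₂.re * v₂.re + v₂.im * v₂.im := by
    rw [hb, Complex.sq_norm, Complex.normSq_apply]
  have ww : ripE w w = (p : ℝ) ^ 2 * c ^ 2 + (q : ℝ) ^ 2 * (a ^ 2 + b ^ 2) := by
    rw [hw, ripE, rinner_complex_smul_self, ← hc2, a_sq, b_sq]
    simp [rc]
    ring
  have X0w : ripE (X 0) w = q * a ^ 2 := by
    rw [hX0, hw, a_sq]
    simp [ripE, rinner_zero_left, rc]
    ring
  have X1w : ripE (X 1) w = q * b ^ 2 := by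
    rw [hX1, hw, b_sq]
    simp [ripE, rinner_zero_left, rc]
    ring
  have X00 : ripE (X 0) (X 0) = a ^ 2 := by
    rw [hX0, a_sq]
    simp [ripE, rinner_zero_left, rc]
  have X11 : ripE (X 1) (X 1) = b ^ 2 := by
    rw [hX1, b_sq]
    simp [ripE, rinner_zero_left, rc]
  have X01 : ripE (X 0) (X 1) = 0 := by
    rw [hX0, hX1]
    simp [ripE, rinner_zero_left, rc]
  have a_pos : 0 < a := hab ▸ norm_pos_iff.mpr hv₁
  have q_pos : (0 : ℝ) < q := Nat.cast_pos.mpr hq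
  have ww_ne : ripE w w ≠ 0 := by
    rw [ww]
    positivity
  rw [hG, Matrix.det_fin_two]
  simp only [Matrix.of_apply, ripE_hor_hor ww_ne, ripE_comm (X 1) (X 0), X00, X01, X11, X0w, X1w]
  rw [sphere, ← ww]
  field_simp
  ring
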